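/- Let I ⊆ A and J ⊆ B be monomial ideals, s ≥ 1, and γ = (α,β) ∈ ℤ^σ × ℤ^τ. Then Δ_γ((I+J)^s) = ⋃_{j=1}^{s} Δ_α(I^j) ∗ Δ_β(J^{s−j+1}); that is, for every subset F of (σ ⊔ τ)∖G_γ, F ∈ Δ_γ((I+J)^s) if and only if there exists j with 1 ≤ j ≤ s such that F ∩ σ ∈ Δ_α(I^j) and F ∩ τ ∈ Δ_β(J^{s−j+1}). -/

import Mathlib

open MvPolynomial

noncomputable section

variable (k : Type*) [Field k]

/-- The multiplicative submonoid of `S = k[x_i : i ∈ σ]` generated by the variables `x_i, i ∈ F`. -/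
def varSubmonoid (σ : Type*) (F : Set σ) : Submonoid (MvPolynomial σ k) :=
  Submonoid.closure ((fun i => (X i : MvPolynomial σ k)) '' F)

/-- The localization `S_F` of `S` at the variables indexed by `F`. -/
abbrev Loc (σ : Type*) (F : Set σ) : Type _ := Localization (varSubmonoid k σ F)

/-- The ideal `I S_F` of `S_F` generated by the image of `I`. -/
def locIdeal {σ : Type*} (I : Ideal (MvPolynomial σ k)) (F : Set σ) : Ideal (Loc k σ F) :=
  Ideal.map (algebraMap (MvPolynomial σ k) (Loc k σ F)) I

/-- `G_γ = {i | γ i < 0}`. -/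
def negSupp {σ : Type*} (γ : σ → ℤ) : Set σ := {i | γ i < 0}

/-- The element `x^γ` of `S_F` (meaningful when `G_γ ⊆ F`):  the image of the monomial with
exponents `max (γ i) 0` multiplied by the inverse of the image of `∏ x_i ^ (-γ i)` over `G_γ`. -/
def xpow {σ : Type*} [Fintype σ] (F : Set σ) (γ : σ → ℤ) : Loc k σ F :=
  algebraMap (MvPolynomial σ k) (Loc k σ F) (∏ i, X i ^ (γ i).toNat) *
    Ring.inverse (algebraMap (MvPolynomial σ k) (Loc k σ F) (∏ i, X i ^ (-γ i).toNat))

/-- The degree complex `Δ_γ(I)`: all `F ⊆ σ \ G_γ` with `x^γ ∉ I S_{F ∪ G_γ}`. -/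
def degCx {σ : Type*} [Fintype σ] (I : Ideal (MvPolynomial σ k)) (γ : σ → ℤ) : Set (Set σ) :=
  {F | F ⊆ (negSupp γ)ᶜ ∧ xpow k (F ∪ negSupp γ) γ ∉ locIdeal k I (F ∪ negSupp γ)}

/-- A monomial ideal is an ideal generated by monomials. -/
def IsMonomialIdeal {σ : Type*} (I : Ideal (MvPolynomial σ k)) : Prop :=
  ∃ G : Set (σ →₀ ℕ),
    I = Ideal.span ((fun d => (monomial d (1 : k) : MvPolynomial σ k)) '' G)

/-- Extension of an ideal of `A = k[x_i : i ∈ σ]` to `S = k[x_i : i ∈ σ ⊕ τ]` along the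
renaming of variables by `Sum.inl`. -/
def extL {σ τ : Type*} (I : Ideal (MvPolynomial σ k)) : Ideal (MvPolynomial (σ ⊕ τ) k) :=
  Ideal.map (rename (Sum.inl : σ → σ ⊕ τ) :
    MvPolynomial σ k →ₐ[k] MvPolynomial (σ ⊕ τ) k).toRingHom I

/-- Extension of an ideal of `B = k[x_i : i ∈ τ]` to `S = k[x_i : i ∈ σ ⊕ τ]` along the
renaming of variables by `Sum.inr`. -/
def extR {σ τ : Type*} (J : Ideal (MvPolynomial τ k)) : Ideal (MvPolynomial (σ ⊕ τ) k) :=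
  Ideal.map (rename (Sum.inr : τ → σ ⊕ τ) :
    MvPolynomial τ k →ₐ[k] MvPolynomial (σ ⊕ τ) k).toRingHom J

/-- The maximal homogeneous ideal, generated by all the variables. -/
def maxIdeal (σ : Type*) : Ideal (MvPolynomial σ k) :=
  Ideal.span (Set.range (X : σ → MvPolynomial σ k))

lemma mem_varSubmonoid_iff {σ : Type*} {F : Set σ} {p : MvPolynomial σ k} :
    p ∈ varSubmonoid k σ F ↔ ∃ d : σ →₀ ℕ, ↑d.support ⊆ F ∧ p = monomial d 1 := by
  classical
  constructor
  · intro hp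
    induction hp using Submonoid.closure_induction with
    | mem x hx =>
      obtain ⟨i, hi, rfl⟩ := hx
      refine ⟨Finsupp.single i 1, ?_, rfl⟩
      exact (Finset.coe_subset.2 Finsupp.support_single_subset).trans (by simpa using hi)
    | one => exact ⟨0, by simp, rfl⟩
    | mul x y _ _ hx hy =>
      obtain ⟨d, hd, rfl⟩ := hx
      obtain ⟨e, he, rfl⟩ := hy
      refine ⟨d + e, ?_, by simp [monomial_mul]⟩
      refine (Finset.coe_subset.2 Finsupp.support_add).trans ?_
      rw [Finset.coe_union]
      exact Set.union_subset hd he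
  · rintro ⟨d, hd, rfl⟩
    rw [← prod_X_pow_eq_monomial]
    exact Submonoid.prod_mem _ fun i hi =>
      Submonoid.pow_mem _ (Submonoid.subset_closure (Set.mem_image_of_mem _ (hd hi))) _

lemma prod_X_pow_eq_monomial_equivFunOnFinite {σ : Type*} [Fintype σ] (f : σ → ℕ) :
    (∏ i, X i ^ f i : MvPolynomial σ k) = monomial (Finsupp.equivFunOnFinite.symm f) 1 := by
  rw [monomial_eq, Finsupp.prod_fintype _ _ (by simp)]
  simp

/-- The exponent vector with entries `max (γ i) 0`. -/
def posExp {σ : Type*} [Fintype σ] (γ : σ → ℤ) : σ →₀ ℕ :=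
  Finsupp.equivFunOnFinite.symm fun i => (γ i).toNat

lemma xpow_mem_locIdeal_iff {σ : Type*} [Fintype σ] (K : Ideal (MvPolynomial σ k))
    {F : Set σ} {γ : σ → ℤ} (hF : negSupp γ ⊆ F) :
    xpow k F γ ∈ locIdeal k K F ↔
      ∃ d : σ →₀ ℕ, ↑d.support ⊆ F ∧ monomial (d + posExp γ) (1 : k) ∈ K := by
  have hneg : (∏ i, X i ^ (-γ i).toNat : MvPolynomial σ k) ∈ varSubmonoid k σ F := by
    refine Submonoid.prod_mem _ fun i _ => ?_
    by_cases hi : γ i < 0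
    · exact Submonoid.pow_mem _ (Submonoid.subset_closure (Set.mem_image_of_mem _ (hF hi))) _
    · rw [Int.toNat_of_nonpos (by omega), pow_zero]
      exact Submonoid.one_mem _
  have hunit : IsUnit (Ring.inverse (algebraMap (MvPolynomial σ k) (Loc k σ F)
      (∏ i, X i ^ (-γ i).toNat))) :=
    (IsLocalization.map_units (Loc k σ F) ⟨_, hneg⟩).ringInverse
  rw [xpow, Ideal.mul_unit_mem_iff_mem _ hunit, locIdeal,
    IsLocalization.algebraMap_mem_map_algebraMap_iff (varSubmonoid k σ F),
    prod_X_pow_eq_monomial_equivFunOnFinite]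
  constructor
  · rintro ⟨m, hm, h⟩
    obtain ⟨d, hd, rfl⟩ := (mem_varSubmonoid_iff k).1 hm
    exact ⟨d, hd, by simpa [monomial_mul, posExp] using h⟩
  · rintro ⟨d, hd, h⟩
    exact ⟨monomial d 1, (mem_varSubmonoid_iff k).2 ⟨d, hd, rfl⟩,
      by simpa [monomial_mul, posExp] using h⟩

lemma monomial_mem_of_le {σ : Type*} {K : Ideal (MvPolynomial σ k)} {d e : σ →₀ ℕ}
    (hde : d ≤ e) (hd : monomial d (1 : k) ∈ K) : monomial e (1 : k) ∈ K := by
  obtain ⟨c, rfl⟩ := exists_add_of_le hde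
  simpa [monomial_mul] using K.mul_mem_right (monomial c 1) hd

/-- The `σ`-part of an exponent vector on `σ ⊕ τ`. -/
def leftExp {σ τ : Type*} : (σ ⊕ τ →₀ ℕ) →+ (σ →₀ ℕ) :=
  Finsupp.comapDomain.addMonoidHom Sum.inl_injective

/-- The `τ`-part of an exponent vector on `σ ⊕ τ`. -/
def rightExp {σ τ : Type*} : (σ ⊕ τ →₀ ℕ) →+ (τ →₀ ℕ) :=
  Finsupp.comapDomain.addMonoidHom Sum.inr_injective

@[simp] lemma leftExp_apply {σ τ : Type*} (e : σ ⊕ τ →₀ ℕ) (i : σ) :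
    leftExp e i = e (Sum.inl i) := rfl

@[simp] lemma rightExp_apply {σ τ : Type*} (e : σ ⊕ τ →₀ ℕ) (i : τ) :
    rightExp e i = e (Sum.inr i) := rfl

lemma mapDomain_leftExp_add_mapDomain_rightExp {σ τ : Type*} (e : σ ⊕ τ →₀ ℕ) :
    (leftExp e).mapDomain Sum.inl + (rightExp e).mapDomain Sum.inr = e := by
  ext (i | i)
  · rw [Finsupp.add_apply, Finsupp.mapDomain_apply Sum.inl_injective,
      Finsupp.mapDomain_of_notMem_range _ _ (by simp), leftExp_apply, add_zero]
  · rw [Finsupp.add_apply, Finsupp.mapDomain_apply Sum.inr_injective,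
      Finsupp.mapDomain_of_notMem_range _ _ (by simp), rightExp_apply, zero_add]

/-- The exponents of the monomials in `∑ i ≤ s, I ^ i * J ^ (s - i)`. -/
def sumPowExps {σ τ : Type*} (I : Ideal (MvPolynomial σ k)) (J : Ideal (MvPolynomial τ k))
    (s : ℕ) : Set (σ ⊕ τ →₀ ℕ) :=
  {e | ∃ i ≤ s, monomial (leftExp e) (1 : k) ∈ I ^ i ∧
    monomial (rightExp e) (1 : k) ∈ J ^ (s - i)}

lemma sumPowExps_add_left {σ τ : Type*} {I : Ideal (MvPolynomial σ k)}
    {J : Ideal (MvPolynomial τ k)} {s : ℕ} {d : σ →₀ ℕ} {e : σ ⊕ τ →₀ ℕ}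
    (hd : monomial d (1 : k) ∈ I) (he : e ∈ sumPowExps k I J s) :
    e + d.mapDomain Sum.inl ∈ sumPowExps k I J (s + 1) := by
  obtain ⟨i, hi, hl, hr⟩ := he
  have h₁ : leftExp (d.mapDomain (Sum.inl : σ → σ ⊕ τ)) = d := by
    ext j
    rw [leftExp_apply, Finsupp.mapDomain_apply Sum.inl_injective]
  have h₂ : rightExp (d.mapDomain (Sum.inl : σ → σ ⊕ τ)) = 0 := by
    ext j
    rw [rightExp_apply, Finsupp.mapDomain_of_notMem_range _ _ (by simp), Finsupp.zero_apply]
  refine ⟨i + 1, by omega, ?_, ?_⟩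
  · rw [map_add, h₁, pow_succ]
    simpa [monomial_mul] using Ideal.mul_mem_mul hl hd
  · rwa [map_add, h₂, add_zero, Nat.add_sub_add_right]

lemma sumPowExps_add_right {σ τ : Type*} {I : Ideal (MvPolynomial σ k)}
    {J : Ideal (MvPolynomial τ k)} {s : ℕ} {d : τ →₀ ℕ} {e : σ ⊕ τ →₀ ℕ}
    (hd : monomial d (1 : k) ∈ J) (he : e ∈ sumPowExps k I J s) :
    e + d.mapDomain Sum.inr ∈ sumPowExps k I J (s + 1) := by
  obtain ⟨i, hi, hl, hr⟩ := he
  have h₁ : rightExp (d.mapDomain (Sum.inr : τ → σ ⊕ τ)) = d := by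
    ext j
    rw [rightExp_apply, Finsupp.mapDomain_apply Sum.inr_injective]
  have h₂ : leftExp (d.mapDomain (Sum.inr : τ → σ ⊕ τ)) = 0 := by
    ext j
    rw [leftExp_apply, Finsupp.mapDomain_of_notMem_range _ _ (by simp), Finsupp.zero_apply]
  refine ⟨i, by omega, ?_, ?_⟩
  · rwa [map_add, h₂, add_zero]
  · rw [map_add, h₁, Nat.sub_add_comm hi, pow_succ]
    simpa [monomial_mul] using Ideal.mul_mem_mul hr hd

lemma isUpperSet_sumPowExps {σ τ : Type*} (I : Ideal (MvPolynomial σ k))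
    (J : Ideal (MvPolynomial τ k)) (s : ℕ) : IsUpperSet (sumPowExps k I J s) := by
  rintro d e hde ⟨i, hi, hl, hr⟩
  exact ⟨i, hi, monomial_mem_of_le k (fun j => hde (Sum.inl j)) hl,
    monomial_mem_of_le k (fun j => hde (Sum.inr j)) hr⟩

lemma add_pow_le_span_sumPowExps {σ τ : Type*} {I : Ideal (MvPolynomial σ k)}
    {J : Ideal (MvPolynomial τ k)} (hI : IsMonomialIdeal k I) (hJ : IsMonomialIdeal k J)
    (s : ℕ) :
    (extL k I + extR k J) ^ s ≤
      Ideal.span ((fun d => (monomial d (1 : k))) '' sumPowExps k I J s) := by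
  induction s with
  | zero =>
    have h : (0 : σ ⊕ τ →₀ ℕ) ∈ sumPowExps k I J 0 := ⟨0, le_rfl, by simp, by simp⟩
    rw [pow_zero, Ideal.one_eq_top, top_le_iff, Ideal.eq_top_iff_one]
    exact Ideal.subset_span ⟨0, h, rfl⟩
  | succ s ih =>
    rw [pow_succ, mul_add]
    refine sup_le ?_ ?_
    · refine (Ideal.mul_mono_left ih).trans ?_
      obtain ⟨G, hG⟩ := hI
      have hmem : ∀ d ∈ G, monomial d (1 : k) ∈ I := fun d hd =>
        hG ▸ Ideal.subset_span ⟨d, hd, rfl⟩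
      rw [extL, show Ideal.map _ I = Ideal.map _ (Ideal.span _) from congrArg _ hG,
        Ideal.map_span, Ideal.span_mul_span', Ideal.span_le]
      rintro _ ⟨_, ⟨e, he, rfl⟩, _, ⟨_, ⟨d, hd, rfl⟩, rfl⟩, rfl⟩
      refine Ideal.subset_span ⟨_, sumPowExps_add_left k (hmem d hd) he, ?_⟩
      simp [rename_monomial, monomial_mul]
    · refine (Ideal.mul_mono_left ih).trans ?_
      obtain ⟨G, hG⟩ := hJ
      have hmem : ∀ d ∈ G, monomial d (1 : k) ∈ J := fun d hd =>
        hG ▸ Ideal.subset_span ⟨d, hd, rfl⟩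
      rw [extR, show Ideal.map _ J = Ideal.map _ (Ideal.span _) from congrArg _ hG,
        Ideal.map_span, Ideal.span_mul_span', Ideal.span_le]
      rintro _ ⟨_, ⟨e, he, rfl⟩, _, ⟨_, ⟨d, hd, rfl⟩, rfl⟩, rfl⟩
      refine Ideal.subset_span ⟨_, sumPowExps_add_right k (hmem d hd) he, ?_⟩
      simp [rename_monomial, monomial_mul]

lemma monomial_mem_add_pow_iff {σ τ : Type*} {I : Ideal (MvPolynomial σ k)}
    {J : Ideal (MvPolynomial τ k)} (hI : IsMonomialIdeal k I) (hJ : IsMonomialIdeal k J)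
    (s : ℕ) (e : σ ⊕ τ →₀ ℕ) :
    monomial e (1 : k) ∈ (extL k I + extR k J) ^ s ↔
      ∃ i ≤ s, monomial (leftExp e) (1 : k) ∈ I ^ i ∧
        monomial (rightExp e) (1 : k) ∈ J ^ (s - i) := by
  classical
  constructor
  · intro h
    obtain ⟨d, hd, hde⟩ := mem_ideal_span_monomial_image.1
      (add_pow_le_span_sumPowExps k hI hJ s h) e (by simp [mem_support_iff])
    exact isUpperSet_sumPowExps k I J s hde hd
  · rintro ⟨i, hi, hl, hr⟩
    have hle : extL k I ^ i * extR k J ^ (s - i) ≤ (extL k I + extR k J) ^ s := by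
      calc extL k I ^ i * extR k J ^ (s - i)
          ≤ (extL k I + extR k J) ^ i * (extL k I + extR k J) ^ (s - i) :=
            Ideal.mul_mono (Ideal.pow_right_mono le_sup_left i)
              (Ideal.pow_right_mono le_sup_right (s - i))
        _ = (extL k I + extR k J) ^ s := by rw [← pow_add, Nat.add_sub_cancel' hi]
    apply hle
    rw [extL, extR, ← Ideal.map_pow, ← Ideal.map_pow]
    have := Ideal.mul_mem_mul
      (Ideal.mem_map_of_mem (rename (Sum.inl : σ → σ ⊕ τ) :
        MvPolynomial σ k →ₐ[k] MvPolynomial (σ ⊕ τ) k).toRingHom hl)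
      (Ideal.mem_map_of_mem (rename (Sum.inr : τ → σ ⊕ τ) :
        MvPolynomial τ k →ₐ[k] MvPolynomial (σ ⊕ τ) k).toRingHom hr)
    simpa [rename_monomial, monomial_mul, mapDomain_leftExp_add_mapDomain_rightExp] using this

lemma xpow_mem_locIdeal_add_pow_iff {σ τ : Type*} [Fintype σ] [Fintype τ]
    {I : Ideal (MvPolynomial σ k)} {J : Ideal (MvPolynomial τ k)}
    (hI : IsMonomialIdeal k I) (hJ : IsMonomialIdeal k J) (s : ℕ) {α : σ → ℤ} {β : τ → ℤ}
    {F : Set (σ ⊕ τ)} (hF : negSupp (Sum.elim α β) ⊆ F) :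
    xpow k F (Sum.elim α β) ∈ locIdeal k ((extL k I + extR k J) ^ s) F ↔
      ∃ i ≤ s, xpow k (Sum.inl ⁻¹' F) α ∈ locIdeal k (I ^ i) (Sum.inl ⁻¹' F) ∧
        xpow k (Sum.inr ⁻¹' F) β ∈ locIdeal k (J ^ (s - i)) (Sum.inr ⁻¹' F) := by
  have hα : negSupp α ⊆ Sum.inl ⁻¹' F := fun i hi => hF (a := Sum.inl i) hi
  have hβ : negSupp β ⊆ Sum.inr ⁻¹' F := fun i hi => hF (a := Sum.inr i) hi
  have hl : leftExp (posExp (Sum.elim α β)) = posExp α := by ext; rfl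
  have hr : rightExp (posExp (Sum.elim α β)) = posExp β := by ext; rfl
  simp only [xpow_mem_locIdeal_iff k _ hF, xpow_mem_locIdeal_iff k _ hα,
    xpow_mem_locIdeal_iff k _ hβ, monomial_mem_add_pow_iff k hI hJ, map_add, hl, hr]
  constructor
  · rintro ⟨d, hd, i, hi, h₁, h₂⟩
    refine ⟨i, hi, ⟨leftExp d, fun j hj => hd ?_, h₁⟩, ⟨rightExp d, fun j hj => hd ?_, h₂⟩⟩
    · simpa using hj
    · simpa using hj
  · rintro ⟨i, hi, ⟨d, hd, h₁⟩, ⟨e, he, h₂⟩⟩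
    have hde₁ : leftExp (Finsupp.sumElim d e) = d := by ext; simp
    have hde₂ : rightExp (Finsupp.sumElim d e) = e := by ext; simp
    refine ⟨Finsupp.sumElim d e, ?_, i, hi, by rwa [hde₁], by rwa [hde₂]⟩
    rintro (j | j) hj
    · exact hd (by simpa using hj)
    · exact he (by simpa using hj)

lemma locIdeal_pow_antitone {σ : Type*} (I : Ideal (MvPolynomial σ k)) (F : Set σ) :
    Antitone fun n => locIdeal k (I ^ n) F :=
  fun _ _ h => Ideal.map_mono (Ideal.pow_le_pow_right h)

lemma not_exists_and_sub_iff {p q : ℕ → Prop} (hp : ∀ m n, m ≤ n → p n → p m)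
    (hq : ∀ m n, m ≤ n → q n → q m) (hp₀ : p 0) (hq₀ : q 0) (s : ℕ) :
    (¬ ∃ i ≤ s, p i ∧ q (s - i)) ↔ ∃ j, 1 ≤ j ∧ j ≤ s ∧ ¬ p j ∧ ¬ q (s - j + 1) := by
  classical
  constructor
  · intro h
    push Not at h
    have hps : ¬ p s := fun hs => h s le_rfl hs (by simpa using hq₀)
    have hex : ∃ n, ¬ p n := ⟨s, hps⟩
    have hpos : 1 ≤ Nat.find hex := by
      by_contra hlt
      exact Nat.find_spec hex (by rwa [show Nat.find hex = 0 by omega])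
    have hle : Nat.find hex ≤ s := Nat.find_min' hex hps
    refine ⟨Nat.find hex, hpos, hle, Nat.find_spec hex, ?_⟩
    have := h (Nat.find hex - 1) (by omega)
      (not_not.1 (Nat.find_min hex (by omega : Nat.find hex - 1 < Nat.find hex)))
    rwa [show s - Nat.find hex + 1 = s - (Nat.find hex - 1) by omega]
  · rintro ⟨j, hj₁, hjs, hpj, hqj⟩ ⟨i, hi, hpi, hqi⟩
    rcases le_or_gt j i with hji | hij
    · exact hpj (hp j i hji hpi)
    · exact hqj (hq _ _ (by omega) hqi)

/-- for monomial ideals `I ⊆ A`, `J ⊆ B`, `s ≥ 1` and `γ = (α, β)`,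
`Δ_γ((I+J)^s) = ⋃_{j=1}^s Δ_α(I^j) ∗ Δ_β(J^{s-j+1})`: for every `F ⊆ (σ ⊔ τ) \ G_γ`,
`F ∈ Δ_γ((I+J)^s)` iff there is `1 ≤ j ≤ s` with `F ∩ σ ∈ Δ_α(I^j)` and
`F ∩ τ ∈ Δ_β(J^{s-j+1})`. -/
theorem statement10 {σ τ : Type*} [Fintype σ] [Fintype τ]
    (I : Ideal (MvPolynomial σ k)) (J : Ideal (MvPolynomial τ k))
    (hI : IsMonomialIdeal k I) (hJ : IsMonomialIdeal k J)
    (s : ℕ) (hs : 1 ≤ s) (α : σ → ℤ) (β : τ → ℤ) :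
    ∀ F : Set (σ ⊕ τ), F ⊆ (negSupp (Sum.elim α β))ᶜ →
      (F ∈ degCx k ((extL k I + extR k J) ^ s) (Sum.elim α β) ↔
        ∃ j : ℕ, 1 ≤ j ∧ j ≤ s ∧ Sum.inl ⁻¹' F ∈ degCx k (I ^ j) α ∧
          Sum.inr ⁻¹' F ∈ degCx k (J ^ (s - j + 1)) β) := by
  intro F hF
  have hG : negSupp (Sum.elim α β) ⊆ F ∪ negSupp (Sum.elim α β) := Set.subset_union_right
  have hα : Sum.inl ⁻¹' F ⊆ (negSupp α)ᶜ := fun i hi => hF (a := Sum.inl i) hi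
  have hβ : Sum.inr ⁻¹' F ⊆ (negSupp β)ᶜ := fun i hi => hF (a := Sum.inr i) hi
  simp only [degCx, Set.mem_ofPred_eq, hF, hα, hβ, true_and,
    xpow_mem_locIdeal_add_pow_iff k hI hJ s hG]
  exact not_exists_and_sub_iff (fun _ _ h hx => locIdeal_pow_antitone k I _ h hx)
    (fun _ _ h hx => locIdeal_pow_antitone k J _ h hx)
    (by simp only [locIdeal, pow_zero, Ideal.one_eq_top, Ideal.map_top, Submodule.mem_top])
    (by simp only [locIdeal, pow_zero, Ideal.one_eq_top, Ideal.map_top, Submodule.mem_top]) s
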